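/- arXiv:2601.03833 — 3 statements merged into one kernel-verified Lean document; each statement's English description precedes it below -/
import Mathlib

section
/- There exists a constant C > 0 such that for all x ∈ ℝ², ∫_0^1 ∫_{ℝ²} (√(1−s) + |x−y|)^{−3} (√s + |y|)^{−2} dy ds ≤ C/(1+|x|²). -/
open MeasureTheory Real

noncomputable section

abbrev E2 : Type := EuclideanSpace ℝ (Fin 2)

lemma integrable_inv_add_norm_pow_three {a : ℝ} (ha : 0 < a) :
    Integrable (fun y : E2 => ((a + ‖y‖) ^ 3)⁻¹) := by
  have h1 : Integrable (fun y : E2 => (1 + ‖y‖) ^ (-(3 : ℝ))) :=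
    integrable_one_add_norm (by simp; norm_num)
  have h2 := (h1.comp_smul (inv_ne_zero ha.ne')).const_mul ((a ^ 3)⁻¹)
  refine h2.congr (Filter.Eventually.of_forall fun y => ?_)
  have hy := norm_nonneg y
  have h3 : (3 : ℝ) = ((3 : ℕ) : ℝ) := by norm_num
  simp only [norm_smul, norm_inv, Real.norm_eq_abs, abs_of_pos ha]
  rw [rpow_neg (by positivity), h3, rpow_natCast, ← mul_inv, ← mul_pow]
  congr 2
  field_simp

lemma integral_inv_add_norm_pow_three {a : ℝ} (ha : 0 < a) :
    ∫ y : E2, ((a + ‖y‖) ^ 3)⁻¹ = a⁻¹ * ∫ y : E2, ((1 + ‖y‖) ^ 3)⁻¹ := by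
  have h := Measure.integral_comp_smul (volume : Measure E2)
    (fun y : E2 => ((1 + ‖y‖) ^ 3)⁻¹) a⁻¹
  have h2 : ∀ y : E2, ((a + ‖y‖) ^ 3)⁻¹ = (a ^ 3)⁻¹ * ((1 + ‖a⁻¹ • y‖) ^ 3)⁻¹ := fun y => by
    rw [norm_smul, norm_inv, Real.norm_eq_abs, abs_of_pos ha, ← mul_inv, ← mul_pow]
    congr 2
    field_simp
  simp_rw [h2]
  rw [integral_const_mul, h, finrank_euclideanSpace_fin, smul_eq_mul, abs_of_pos (by positivity)]
  field_simp

lemma kernel_pointwise_bound {A B t : ℝ} (hA : 0 < A) (hB : 0 < B) (ht : t ≤ (A + B) ^ 2) :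
    t * ((A ^ 3)⁻¹ * (B ^ 2)⁻¹) ≤ 3 * ((A ^ 3)⁻¹ + (B ^ 3)⁻¹) := by
  calc t * ((A ^ 3)⁻¹ * (B ^ 2)⁻¹) ≤ (A + B) ^ 2 * ((A ^ 3)⁻¹ * (B ^ 2)⁻¹) := by gcongr
    _ ≤ 3 * ((A ^ 3)⁻¹ + (B ^ 3)⁻¹) := by
      obtain ⟨p, rfl⟩ : ∃ p, A = p⁻¹ := ⟨A⁻¹, by simp⟩
      obtain ⟨q, rfl⟩ : ∃ q, B = q⁻¹ := ⟨B⁻¹, by simp⟩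
      have hp : 0 < p := inv_pos.mp hA
      have hq : 0 < q := inv_pos.mp hB
      have e : (p⁻¹ + q⁻¹) ^ 2 * ((p⁻¹ ^ 3)⁻¹ * (q⁻¹ ^ 2)⁻¹) = p * (p + q) ^ 2 := by
        field_simp
        ring
      rw [e]
      simp only [inv_pow, inv_inv]
      nlinarith [mul_nonneg (add_pos hp hq).le (sq_nonneg (p - q)), pow_pos hp 3, pow_pos hq 3,
        mul_nonneg hp.le (sq_nonneg (p - q)), mul_nonneg hq.le (sq_nonneg (p - q))]

lemma integral_kernel_le {a b : ℝ} (ha : 0 < a) (hb : 0 < b) (hab : 1 ≤ a + b) (x : E2) :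
    ∫ y : E2, ((a + ‖x - y‖) ^ 3)⁻¹ * ((b + ‖y‖) ^ 2)⁻¹ ≤
      (1 + ‖x‖ ^ 2)⁻¹ * (3 * ((a⁻¹ + b⁻¹) * ∫ y : E2, ((1 + ‖y‖) ^ 3)⁻¹)) := by
  have hia := (integrable_inv_add_norm_pow_three ha).comp_sub_left x
  have hib := integrable_inv_add_norm_pow_three hb
  have hint : ∫ y : E2, (1 + ‖x‖ ^ 2)⁻¹ * (3 * (((a + ‖x - y‖) ^ 3)⁻¹ + ((b + ‖y‖) ^ 3)⁻¹)) =
      (1 + ‖x‖ ^ 2)⁻¹ * (3 * ((a⁻¹ + b⁻¹) * ∫ y : E2, ((1 + ‖y‖) ^ 3)⁻¹)) := by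
    rw [integral_const_mul, integral_const_mul, integral_add hia hib,
      integral_sub_left_eq_self (fun y : E2 => ((a + ‖y‖) ^ 3)⁻¹),
      integral_inv_add_norm_pow_three ha, integral_inv_add_norm_pow_three hb, add_mul]
  rw [← hint]
  refine integral_mono_of_nonneg (Filter.Eventually.of_forall fun y => by positivity)
    (((hia.add hib).const_mul 3).const_mul _) (Filter.Eventually.of_forall fun y => ?_)
  have hx : ‖x‖ ≤ ‖x - y‖ + ‖y‖ := by simpa using norm_add_le (x - y) y
  have hx0 := norm_nonneg x
  have key := kernel_pointwise_bound (A := a + ‖x - y‖) (B := b + ‖y‖) (t := 1 + ‖x‖ ^ 2)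
    (by positivity) (by positivity) (by nlinarith)
  exact (le_inv_mul_iff₀ (by positivity)).mpr key

lemma integrableOn_inv_sqrt_one_sub_add_inv_sqrt :
    IntegrableOn (fun s : ℝ => (√(1 - s))⁻¹ + (√s)⁻¹) (Set.Ioo 0 1) := by
  have h : IntervalIntegrable (fun s : ℝ => (√s)⁻¹) volume 0 1 := by
    refine (intervalIntegral.intervalIntegrable_rpow' (r := -(1 / 2)) (by norm_num)).congr ?_
    rw [Set.uIoc_of_le zero_le_one]
    intro s hs
    simp only [sqrt_eq_rpow, rpow_neg hs.1.le]
  have h' : IntervalIntegrable (fun s : ℝ => (√(1 - s))⁻¹) volume 0 1 := by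
    simpa using (h.comp_sub_left 1).symm
  exact (intervalIntegrable_iff_integrableOn_Ioo_of_le zero_le_one).mp (h'.add h)

/-- There is `C > 0` such that for all `x ∈ ℝ²`,
`∫₀¹ ∫_{ℝ²} (√(1−s)+|x−y|)⁻³ (√s+|y|)⁻² dy ds ≤ C/(1+|x|²)`. -/
theorem kernel_integral_bound :
    ∃ C : ℝ, 0 < C ∧ ∀ x : E2,
      (∫ s in Set.Ioo (0 : ℝ) 1, ∫ y : E2,
          ((Real.sqrt (1 - s) + ‖x - y‖) ^ 3)⁻¹ * ((Real.sqrt s + ‖y‖) ^ 2)⁻¹)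
        ≤ C / (1 + ‖x‖ ^ 2) := by
  set K : ℝ := ∫ y : E2, ((1 + ‖y‖) ^ 3)⁻¹
  set J : ℝ := ∫ s in Set.Ioo (0 : ℝ) 1, ((√(1 - s))⁻¹ + (√s)⁻¹)
  have hK : 0 ≤ K := integral_nonneg fun y => by positivity
  have hJ : 0 ≤ J := integral_nonneg fun s => by positivity
  refine ⟨3 * (J * K) + 1, by positivity, fun x => ?_⟩
  calc _ ≤ ∫ s in Set.Ioo (0 : ℝ) 1,
        (1 + ‖x‖ ^ 2)⁻¹ * (3 * (((√(1 - s))⁻¹ + (√s)⁻¹) * K)) := by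
        refine integral_mono_of_nonneg
          (Filter.Eventually.of_forall fun s => integral_nonneg fun y => by positivity)
          (((integrableOn_inv_sqrt_one_sub_add_inv_sqrt.mul_const K).const_mul 3).const_mul _) ?_
        filter_upwards [ae_restrict_mem measurableSet_Ioo] with s hs
        have h1 : 0 < √(1 - s) := sqrt_pos.mpr (by linarith [hs.2])
        have h0 : 0 < √s := sqrt_pos.mpr hs.1
        refine integral_kernel_le h1 h0 ?_ x
        nlinarith [sq_sqrt hs.1.le, sq_sqrt (sub_nonneg.mpr hs.2.le)]
    _ = (3 * (J * K)) / (1 + ‖x‖ ^ 2) := by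
        rw [integral_const_mul, integral_const_mul, integral_mul_const, div_eq_inv_mul]
    _ ≤ (3 * (J * K) + 1) / (1 + ‖x‖ ^ 2) := by gcongr; linarith
end
end

section
/- There exists a constant C > 0 such that for all x ∈ ℝ², ∫_0^1 s^{−1/2} ∫_{ℝ²} (√(1−s) + |x−y|)^{−3} (√s + |y|)^{−2} dy ds ≤ C/(1+|x|²). -/
open MeasureTheory Real

noncomputable section

theorem add_norm_rpow_eq {c : ℝ} (hc : 0 < c) (r : ℝ) (y : E2) :
    (c + ‖y‖) ^ r = c ^ r * (1 + ‖c⁻¹ • y‖) ^ r := by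
  rw [← Real.mul_rpow hc.le (by positivity), norm_smul, Real.norm_of_nonneg (by positivity)]
  congr 1
  field_simp

theorem integrable_add_norm_rpow {c r : ℝ} (hc : 0 < c) (hr : r < -2) :
    Integrable fun y : E2 => (c + ‖y‖) ^ r := by
  have h : Integrable fun y : E2 => (1 + ‖y‖) ^ r := by
    simpa using integrable_one_add_norm (E := E2) (μ := volume) (r := -r) (by simp; linarith)
  simp_rw [add_norm_rpow_eq hc]
  exact (h.comp_smul (inv_ne_zero hc.ne')).const_mul _

theorem integral_add_norm_rpow {c : ℝ} (hc : 0 < c) (r : ℝ) :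
    ∫ y : E2, (c + ‖y‖) ^ r = c ^ (r + 2) * ∫ y : E2, (1 + ‖y‖) ^ r := by
  simp_rw [add_norm_rpow_eq hc]
  rw [integral_const_mul,
    Measure.integral_comp_inv_smul volume (fun y : E2 => (1 + ‖y‖) ^ r) c, Real.rpow_add hc]
  simp [mul_assoc]

theorem kernel_product_le {a A B n : ℝ} (ha : 0 < a) (hA : a ≤ A) (hB : 0 < B) (hn : 0 ≤ n)
    (h : 1 + n ≤ A + B) :
    (1 + n ^ 2) * ((A ^ 3)⁻¹ * (B ^ 2)⁻¹) ≤
      4 * a ^ (-(1 : ℝ) / 2) * (A ^ (-(5 : ℝ) / 2) + B ^ (-(5 : ℝ) / 2)) := by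
  have hA0 : 0 < A := ha.trans_le hA
  have hAa : A ^ (-(1 : ℝ) / 2) ≤ a ^ (-(1 : ℝ) / 2) :=
    Real.rpow_le_rpow_of_nonpos ha hA (by norm_num)
  have hnum : 1 + n ^ 2 ≤ (A + B) ^ 2 := by nlinarith
  have hB5 : (B ^ 2)⁻¹ * B ^ (-(1 : ℝ) / 2) = B ^ (-(5 : ℝ) / 2) := by
    rw [← Real.rpow_natCast, ← Real.rpow_neg hB.le, ← Real.rpow_add hB]; norm_num
  have hA3 : (A ^ 3)⁻¹ = A ^ (-(1 : ℝ) / 2) * A ^ (-(5 : ℝ) / 2) := by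
    rw [← Real.rpow_natCast, ← Real.rpow_neg hA0.le, ← Real.rpow_add hA0]; norm_num
  have hA1 : A⁻¹ = A ^ (-(1 : ℝ) / 2) * A ^ (-(1 : ℝ) / 2) := by
    rw [← Real.rpow_neg_one, ← Real.rpow_add hA0]; norm_num
  rcases le_total A B with hAB | hAB
  · calc (1 + n ^ 2) * ((A ^ 3)⁻¹ * (B ^ 2)⁻¹)
        ≤ (4 * B ^ 2) * ((A ^ 3)⁻¹ * (B ^ 2)⁻¹) := by
          gcongr; nlinarith
      _ = 4 * (A ^ (-(1 : ℝ) / 2) * A ^ (-(5 : ℝ) / 2)) := by rw [← hA3]; field_simp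
      _ ≤ 4 * (a ^ (-(1 : ℝ) / 2) * A ^ (-(5 : ℝ) / 2)) := by gcongr
      _ ≤ _ := by
          rw [← mul_assoc]
          gcongr
          exact le_add_of_nonneg_right (by positivity)
  · have hBA : A ^ (-(1 : ℝ) / 2) ≤ B ^ (-(1 : ℝ) / 2) :=
      Real.rpow_le_rpow_of_nonpos hB hAB (by norm_num)
    calc (1 + n ^ 2) * ((A ^ 3)⁻¹ * (B ^ 2)⁻¹)
        ≤ (4 * A ^ 2) * ((A ^ 3)⁻¹ * (B ^ 2)⁻¹) := by
          gcongr; nlinarith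
      _ = 4 * (A⁻¹ * (B ^ 2)⁻¹) := by field_simp
      _ ≤ 4 * (a ^ (-(1 : ℝ) / 2) * B ^ (-(1 : ℝ) / 2) * (B ^ 2)⁻¹) := by
          rw [hA1]; gcongr
      _ = 4 * a ^ (-(1 : ℝ) / 2) * B ^ (-(5 : ℝ) / 2) := by rw [← hB5]; ring
      _ ≤ _ := by
          gcongr
          exact le_add_of_nonneg_left (by positivity)

theorem kernel_space_integral_le {a b : ℝ} (ha : 0 < a) (hb : 0 < b) (hab : 1 ≤ a + b) (x : E2) :
    (1 + ‖x‖ ^ 2) * ∫ y : E2, ((a + ‖x - y‖) ^ 3)⁻¹ * ((b + ‖y‖) ^ 2)⁻¹ ≤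
      4 * a ^ (-(1 : ℝ) / 2) * (a ^ (-(1 : ℝ) / 2) + b ^ (-(1 : ℝ) / 2)) *
        ∫ y : E2, (1 + ‖y‖) ^ (-(5 : ℝ) / 2) := by
  have hia : Integrable fun y : E2 => (a + ‖x - y‖) ^ (-(5 : ℝ) / 2) :=
    (integrable_add_norm_rpow ha (by norm_num)).comp_sub_left x
  have hib : Integrable fun y : E2 => (b + ‖y‖) ^ (-(5 : ℝ) / 2) :=
    integrable_add_norm_rpow hb (by norm_num)
  rw [← integral_const_mul]
  calc ∫ y : E2, (1 + ‖x‖ ^ 2) * (((a + ‖x - y‖) ^ 3)⁻¹ * ((b + ‖y‖) ^ 2)⁻¹)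
      ≤ ∫ y : E2, 4 * a ^ (-(1 : ℝ) / 2) *
          ((a + ‖x - y‖) ^ (-(5 : ℝ) / 2) + (b + ‖y‖) ^ (-(5 : ℝ) / 2)) := by
        refine integral_mono_of_nonneg (.of_forall fun y => by positivity)
          ((hia.add hib).const_mul _) (.of_forall fun y => ?_)
        refine kernel_product_le ha (by simp) (by positivity) (norm_nonneg x) ?_
        have := norm_add_le (x - y) y
        rw [sub_add_cancel] at this
        linarith
    _ = _ := by
        rw [integral_const_mul, integral_add hia hib,
          integral_sub_left_eq_self (fun y : E2 => (a + ‖y‖) ^ (-(5 : ℝ) / 2)) volume x,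
          integral_add_norm_rpow ha, integral_add_norm_rpow hb]
        norm_num
        ring

theorem rpow_weight_product_le {s : ℝ} (hs0 : 0 < s) (hs1 : s < 1) :
    s ^ (-(1 : ℝ) / 2) * (√(1 - s) ^ (-(1 : ℝ) / 2) *
        (√(1 - s) ^ (-(1 : ℝ) / 2) + √s ^ (-(1 : ℝ) / 2))) ≤
      4 * (s ^ (-(3 : ℝ) / 4) + (1 - s) ^ (-(3 : ℝ) / 4)) := by
  have ht0 : 0 < 1 - s := by linarith
  have hsqrt {t : ℝ} (ht : 0 < t) : √t ^ (-(1 : ℝ) / 2) = t ^ (-(1 : ℝ) / 4) := by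
    rw [Real.sqrt_eq_rpow, ← Real.rpow_mul ht.le]; norm_num
  have hsq : s ^ (-(1 : ℝ) / 2) = (s ^ (-(1 : ℝ) / 4)) ^ 2 := by
    rw [← Real.rpow_mul_natCast hs0.le]; norm_num
  have hcube {t : ℝ} (ht : 0 < t) : t ^ (-(3 : ℝ) / 4) = (t ^ (-(1 : ℝ) / 4)) ^ 3 := by
    rw [← Real.rpow_mul_natCast ht.le]; norm_num
  have hone {t : ℝ} (ht : 0 < t) (ht1 : t < 1) : 1 ≤ t ^ (-(1 : ℝ) / 4) :=
    Real.one_le_rpow_of_pos_of_le_one_of_nonpos ht ht1.le (by norm_num)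
  have htwo {t : ℝ} (ht : 1 / 2 ≤ t) (ht1 : t < 1) : t ^ (-(3 : ℝ) / 4) ≤ 2 := by
    calc t ^ (-(3 : ℝ) / 4) ≤ t ^ (-1 : ℝ) :=
          Real.rpow_le_rpow_of_exponent_ge (by linarith) ht1.le (by norm_num)
      _ = t⁻¹ := Real.rpow_neg_one t
      _ ≤ (1 / 2)⁻¹ := inv_anti₀ (by norm_num) ht
      _ = 2 := by norm_num
  have hp := hone hs0 hs1
  have hq := hone ht0 (by linarith)
  have hmax : s ^ (-(3 : ℝ) / 4) ≤ 2 ∨ (1 - s) ^ (-(3 : ℝ) / 4) ≤ 2 := by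
    rcases le_total (1 / 2) s with h | h
    · exact .inl (htwo h hs1)
    · exact .inr (htwo (by linarith) (by linarith))
  rw [hcube hs0, hcube ht0] at hmax ⊢
  rw [hsqrt hs0, hsqrt ht0, hsq]
  generalize s ^ (-(1 : ℝ) / 4) = p at *
  generalize (1 - s) ^ (-(1 : ℝ) / 4) = q at *
  have hp0 : 0 < p := by linarith
  have hq0 : 0 < q := by linarith
  calc p ^ 2 * (q * (q + p)) = p ^ 2 * q ^ 2 + p ^ 3 * q := by ring
    _ ≤ p ^ 3 * q ^ 3 + p ^ 3 * q ^ 3 := by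
        have hp3 : p ^ 2 ≤ p ^ 3 := pow_le_pow_right₀ hp (by norm_num)
        have hq3 : q ^ 2 ≤ q ^ 3 := pow_le_pow_right₀ hq (by norm_num)
        have hq1 : q ≤ q ^ 3 := le_self_pow₀ hq (by norm_num)
        gcongr
    _ = 2 * (p ^ 3 * q ^ 3) := by ring
    _ ≤ 2 * (2 * (p ^ 3 + q ^ 3)) := by
        have := pow_pos hp0 3
        have := pow_pos hq0 3
        rcases hmax with h | h <;> nlinarith
    _ = 4 * (p ^ 3 + q ^ 3) := by ring

theorem integrableOn_rpow_add_one_sub_rpow {r : ℝ} (hr : -1 < r) :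
    IntegrableOn (fun s : ℝ => s ^ r + (1 - s) ^ r) (Set.Ioo 0 1) := by
  have h : IntervalIntegrable (fun s : ℝ => s ^ r) volume 0 1 :=
    intervalIntegral.intervalIntegrable_rpow' hr
  have h' : IntervalIntegrable (fun s : ℝ => (1 - s) ^ r) volume 0 1 := by
    simpa using (h.comp_sub_left 1).symm
  exact (intervalIntegrable_iff_integrableOn_Ioo_of_le zero_le_one).1 (h.add h')

/-- There is `C > 0` such that for all `x ∈ ℝ²`,
`∫₀¹ s^{−1/2} ∫_{ℝ²} (√(1−s)+|x−y|)⁻³ (√s+|y|)⁻² dy ds ≤ C/(1+|x|²)`. -/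
theorem kernel_integral_bound_singular :
    ∃ C : ℝ, 0 < C ∧ ∀ x : E2,
      (∫ s in Set.Ioo (0 : ℝ) 1, s ^ (-(1 : ℝ) / 2) * ∫ y : E2,
          ((Real.sqrt (1 - s) + ‖x - y‖) ^ 3)⁻¹ * ((Real.sqrt s + ‖y‖) ^ 2)⁻¹)
        ≤ C / (1 + ‖x‖ ^ 2) := by
  set K := ∫ y : E2, (1 + ‖y‖) ^ (-(5 : ℝ) / 2)
  have hK : 0 ≤ K := integral_nonneg fun y => by positivity
  set J := ∫ s in Set.Ioo (0 : ℝ) 1, 16 * K * (s ^ (-(3 : ℝ) / 4) + (1 - s) ^ (-(3 : ℝ) / 4))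
  have hJ : 0 ≤ J := setIntegral_nonneg measurableSet_Ioo fun s hs => by
    have := sub_pos.2 hs.2
    have := hs.1
    positivity
  refine ⟨J + 1, by positivity, fun x => ?_⟩
  rw [le_div_iff₀ (by positivity), mul_comm, ← integral_const_mul]
  refine le_trans ?_ (le_add_of_nonneg_right zero_le_one)
  refine integral_mono_of_nonneg ?_
    ((integrableOn_rpow_add_one_sub_rpow (by norm_num)).const_mul _) ?_
  · filter_upwards [ae_restrict_mem measurableSet_Ioo] with s hs
    have := hs.1
    have : 0 ≤ ∫ y : E2, ((√(1 - s) + ‖x - y‖) ^ 3)⁻¹ * ((√s + ‖y‖) ^ 2)⁻¹ :=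
      integral_nonneg fun y => by positivity
    positivity
  · filter_upwards [ae_restrict_mem measurableSet_Ioo] with s ⟨hs0, hs1⟩
    have ht0 : 0 < 1 - s := sub_pos.2 hs1
    have hab : 1 ≤ √(1 - s) + √s := by
      have h1 : 1 - s ≤ √(1 - s) := Real.le_sqrt_of_sq_le (by nlinarith)
      have h2 : s ≤ √s := Real.le_sqrt_of_sq_le (by nlinarith)
      linarith
    have hspace := kernel_space_integral_le (Real.sqrt_pos.2 ht0) (Real.sqrt_pos.2 hs0) hab x
    calc _ = s ^ (-(1 : ℝ) / 2) * ((1 + ‖x‖ ^ 2) *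
            ∫ y : E2, ((√(1 - s) + ‖x - y‖) ^ 3)⁻¹ * ((√s + ‖y‖) ^ 2)⁻¹) := by ring
      _ ≤ s ^ (-(1 : ℝ) / 2) * (4 * √(1 - s) ^ (-(1 : ℝ) / 2) *
            (√(1 - s) ^ (-(1 : ℝ) / 2) + √s ^ (-(1 : ℝ) / 2)) * K) := by gcongr
      _ = 4 * K * (s ^ (-(1 : ℝ) / 2) * (√(1 - s) ^ (-(1 : ℝ) / 2) *
            (√(1 - s) ^ (-(1 : ℝ) / 2) + √s ^ (-(1 : ℝ) / 2)))) := by ring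
      _ ≤ 4 * K * (4 * (s ^ (-(3 : ℝ) / 4) + (1 - s) ^ (-(3 : ℝ) / 4))) := by
          exact mul_le_mul_of_nonneg_left (rpow_weight_product_le hs0 hs1) (by positivity)
      _ = _ := by ring
end
end

section
/- For every 0 < β ≤ 1 there exists a constant C(β) > 0 such that for all x ∈ ℝ², ∫_0^1 s^{(β−1)/2} ∫_{ℝ²} (√(1−s) + |x−y|)^{−3} (√s + |y|)^{−(2+β)} dy ds ≤ C(β)/(1+|x|^{2+β}). -/
open MeasureTheory Real

noncomputable section

lemma add_norm_rpow_neg_eq {c : ℝ} (hc : 0 < c) (r : ℝ) (y : E2) :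
    (c + ‖y‖) ^ (-r) = c ^ (-r) * (1 + ‖c⁻¹ • y‖) ^ (-r) := by
  rw [← Real.mul_rpow hc.le (by positivity), norm_smul, Real.norm_of_nonneg (by positivity)]
  congr 1
  field_simp

lemma integrable_add_norm_rpow_neg {c r : ℝ} (hc : 0 < c) (hr : 2 < r) :
    Integrable (fun y : E2 => (c + ‖y‖) ^ (-r)) := by
  simp_rw [add_norm_rpow_neg_eq hc r]
  refine Integrable.const_mul ?_ _
  have h : Integrable (fun y : E2 => (1 + ‖y‖) ^ (-r)) :=
    integrable_one_add_norm (by simpa using hr)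
  exact h.comp_smul (inv_ne_zero hc.ne')

lemma integral_add_norm_rpow_neg {c : ℝ} (hc : 0 < c) (r : ℝ) :
    ∫ y : E2, (c + ‖y‖) ^ (-r) = c ^ (2 - r) * ∫ y : E2, (1 + ‖y‖) ^ (-r) := by
  simp_rw [add_norm_rpow_neg_eq hc r]
  rw [integral_const_mul,
    Measure.integral_comp_inv_smul volume (fun y : E2 => (1 + ‖y‖) ^ (-r)) c]
  have h2 : Module.finrank ℝ E2 = 2 := by simp
  rw [h2, abs_of_nonneg (by positivity), smul_eq_mul, ← mul_assoc, ← Real.rpow_natCast,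
    ← Real.rpow_add hc]
  congr 2
  push_cast
  ring

lemma one_le_sqrt_add_sqrt_one_sub {s : ℝ} (h0 : 0 ≤ s) (h1 : s ≤ 1) :
    1 ≤ √s + √(1 - s) := by
  have hs := Real.sq_sqrt h0
  have ht := Real.sq_sqrt (sub_nonneg.2 h1)
  have := mul_nonneg (Real.sqrt_nonneg s) (Real.sqrt_nonneg (1 - s))
  nlinarith [Real.sqrt_nonneg s, Real.sqrt_nonneg (1 - s)]

lemma rpow_neg_le_of_half_one_add_le {β R p t : ℝ} (hβ : 0 < β) (hR : 0 ≤ R)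
    (ht : 2 + β ≤ t) (ht3 : t ≤ 3) (hp : (1 + R) / 2 ≤ p) :
    p ^ (-t) ≤ 16 / (1 + R ^ (2 + β)) := by
  have hp0 : 0 < p := by linarith
  have h1 : (1 + R) ^ (2 + β) ≤ (1 + R) ^ t :=
    Real.rpow_le_rpow_of_exponent_le (by linarith) ht
  have h2 : (1 + R) ^ t ≤ 8 * p ^ t := by
    calc (1 + R) ^ t ≤ (2 * p) ^ t :=
          Real.rpow_le_rpow (by linarith) (by linarith) (by linarith)
      _ = 2 ^ t * p ^ t := Real.mul_rpow (by norm_num) hp0.le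
      _ ≤ 2 ^ (3 : ℝ) * p ^ t := by
          gcongr
          norm_num
      _ = 8 * p ^ t := by norm_num
  have h3 : 1 ≤ (1 + R) ^ (2 + β) := Real.one_le_rpow (by linarith) (by linarith)
  have h4 : R ^ (2 + β) ≤ (1 + R) ^ (2 + β) :=
    Real.rpow_le_rpow hR (by linarith) (by linarith)
  have hR' : 0 ≤ R ^ (2 + β) := Real.rpow_nonneg hR _
  rw [Real.rpow_neg hp0.le, inv_eq_one_div, div_le_div_iff₀ (by positivity) (by positivity)]
  linarith

lemma rpow_neg_mul_rpow_neg_le {β R p q : ℝ} (hβ0 : 0 < β) (hβ1 : β ≤ 1) (hR : 0 ≤ R)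
    (hp : 0 ≤ p) (hq : 0 ≤ q) (hpq : 1 + R ≤ p + q) :
    p ^ (-(3 : ℝ)) * q ^ (-(2 + β)) ≤
      16 / (1 + R ^ (2 + β)) * (p ^ (-(3 : ℝ)) + q ^ (-(2 + β))) := by
  have hp' : 0 ≤ p ^ (-(3 : ℝ)) := Real.rpow_nonneg hp _
  have hq' : 0 ≤ q ^ (-(2 + β)) := Real.rpow_nonneg hq _
  have hD : 0 ≤ 16 / (1 + R ^ (2 + β)) := by positivity
  rcases le_total ((1 + R) / 2) p with h | h
  · have := rpow_neg_le_of_half_one_add_le hβ0 hR (by linarith) le_rfl h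
    nlinarith [mul_le_mul_of_nonneg_right this hq', mul_nonneg hD hp']
  · have := rpow_neg_le_of_half_one_add_le (p := q) hβ0 hR le_rfl (by linarith) (by linarith)
    nlinarith [mul_le_mul_of_nonneg_right this hp', mul_nonneg hD hq']

lemma integral_kernel_mul_weight_le {β s : ℝ} (hβ0 : 0 < β) (hβ1 : β ≤ 1)
    (hs0 : 0 < s) (hs1 : s < 1) (x : E2) :
    ∫ y : E2, ((√(1 - s) + ‖x - y‖) ^ 3)⁻¹ * ((√s + ‖y‖) ^ (2 + β))⁻¹ ≤
      16 / (1 + ‖x‖ ^ (2 + β)) *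
        ((1 - s) ^ (-(1 / 2) : ℝ) * (∫ y : E2, (1 + ‖y‖) ^ (-(3 : ℝ))) +
          s ^ (-β / 2) * ∫ y : E2, (1 + ‖y‖) ^ (-(2 + β))) := by
  have ha : 0 < √(1 - s) := Real.sqrt_pos.2 (by linarith)
  have hb : 0 < √s := Real.sqrt_pos.2 hs0
  have hI1 : Integrable (fun y : E2 => (√(1 - s) + ‖x - y‖) ^ (-(3 : ℝ))) :=
    (integrable_add_norm_rpow_neg ha (by norm_num)).comp_sub_left x
  have hI2 : Integrable (fun y : E2 => (√s + ‖y‖) ^ (-(2 + β))) :=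
    integrable_add_norm_rpow_neg hb (by linarith)
  have hJ1 : ∫ y : E2, (√(1 - s) + ‖x - y‖) ^ (-(3 : ℝ)) =
      (1 - s) ^ (-(1 / 2) : ℝ) * ∫ y : E2, (1 + ‖y‖) ^ (-(3 : ℝ)) := by
    rw [integral_sub_left_eq_self (fun y : E2 => (√(1 - s) + ‖y‖) ^ (-(3 : ℝ))) volume x,
      integral_add_norm_rpow_neg ha, Real.sqrt_eq_rpow, ← Real.rpow_mul (by linarith)]
    norm_num
  have hJ2 : ∫ y : E2, (√s + ‖y‖) ^ (-(2 + β)) =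
      s ^ (-β / 2) * ∫ y : E2, (1 + ‖y‖) ^ (-(2 + β)) := by
    rw [integral_add_norm_rpow_neg hb, Real.sqrt_eq_rpow, ← Real.rpow_mul hs0.le]
    congr 2
    ring
  rw [← hJ1, ← hJ2, ← integral_add hI1 hI2, ← integral_const_mul]
  refine integral_mono_of_nonneg (.of_forall fun y => by positivity)
    ((hI1.add hI2).const_mul _) (.of_forall fun y => ?_)
  have hxy : ‖x‖ ≤ ‖x - y‖ + ‖y‖ := by simpa using norm_add_le (x - y) y
  have key := rpow_neg_mul_rpow_neg_le (p := √(1 - s) + ‖x - y‖) (q := √s + ‖y‖) hβ0 hβ1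
    (norm_nonneg x) (by positivity) (by positivity)
    (by linarith [one_le_sqrt_add_sqrt_one_sub hs0.le hs1.le])
  refine le_trans (le_of_eq ?_) key
  rw [Real.rpow_neg (by positivity), Real.rpow_neg (by positivity)]
  norm_cast

lemma rpow_neg_half_mul_le {s : ℝ} (hs0 : 0 < s) (hs1 : s < 1) :
    s ^ (-(1 / 2) : ℝ) * (1 - s) ^ (-(1 / 2) : ℝ) ≤
      s ^ (-(1 / 2) : ℝ) + (1 - s) ^ (-(1 / 2) : ℝ) := by
  have ha : 0 < √(1 - s) := Real.sqrt_pos.2 (by linarith)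
  have hb : 0 < √s := Real.sqrt_pos.2 hs0
  rw [Real.rpow_neg hs0.le, Real.rpow_neg (by linarith), ← Real.sqrt_eq_rpow,
    ← Real.sqrt_eq_rpow, ← mul_inv, inv_add_inv hb.ne' ha.ne', inv_eq_one_div]
  gcongr
  exact one_le_sqrt_add_sqrt_one_sub hs0.le hs1.le

lemma integrableOn_rpow_neg_half :
    IntegrableOn (fun s : ℝ => s ^ (-(1 / 2) : ℝ)) (Set.Ioo 0 1) :=
  (intervalIntegral.integrableOn_Ioo_rpow_iff one_pos).2 (by norm_num)

lemma integrableOn_one_sub_rpow_neg_half :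
    IntegrableOn (fun s : ℝ => (1 - s) ^ (-(1 / 2) : ℝ)) (Set.Ioo 0 1) := by
  have h : IntervalIntegrable (fun s : ℝ => s ^ (-(1 / 2) : ℝ)) volume 0 1 :=
    intervalIntegral.intervalIntegrable_rpow' (by norm_num)
  have h' := (h.comp_sub_left 1).symm
  simp only [sub_self, sub_zero] at h'
  exact (intervalIntegrable_iff_integrableOn_Ioo_of_le zero_le_one).1 h'

/-- For every `0 < β ≤ 1` there is `C(β) > 0` such that for all `x ∈ ℝ²`,
`∫₀¹ s^{(β−1)/2} ∫_{ℝ²} (√(1−s)+|x−y|)⁻³ (√s+|y|)^{−(2+β)} dy ds ≤ C(β)/(1+|x|^{2+β})`. -/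
theorem kernel_integral_bound_holder (β : ℝ) (hβ0 : 0 < β) (hβ1 : β ≤ 1) :
    ∃ C : ℝ, 0 < C ∧ ∀ x : E2,
      (∫ s in Set.Ioo (0 : ℝ) 1, s ^ ((β - 1) / 2) * ∫ y : E2,
          ((Real.sqrt (1 - s) + ‖x - y‖) ^ 3)⁻¹ * ((Real.sqrt s + ‖y‖) ^ (2 + β))⁻¹)
        ≤ C / (1 + ‖x‖ ^ (2 + β)) := by
  set A : ℝ := ∫ y : E2, (1 + ‖y‖) ^ (-(3 : ℝ))
  set B : ℝ := ∫ y : E2, (1 + ‖y‖) ^ (-(2 + β))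
  have hA0 : 0 ≤ A := integral_nonneg fun y => by positivity
  have hB0 : 0 ≤ B := integral_nonneg fun y => by positivity
  set G : ℝ → ℝ := fun s =>
    A * (s ^ (-(1 / 2) : ℝ) + (1 - s) ^ (-(1 / 2) : ℝ)) + B * s ^ (-(1 / 2) : ℝ) with hG
  have hGint : IntegrableOn G (Set.Ioo 0 1) :=
    ((integrableOn_rpow_neg_half.add integrableOn_one_sub_rpow_neg_half).const_mul A).add
      (integrableOn_rpow_neg_half.const_mul B)
  have hJ0 : 0 ≤ ∫ s in Set.Ioo (0 : ℝ) 1, G s := by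
    refine setIntegral_nonneg measurableSet_Ioo fun s hs => ?_
    have h0 : 0 < s := hs.1
    have h1 : 0 < 1 - s := sub_pos.2 hs.2
    positivity
  refine ⟨16 * (∫ s in Set.Ioo (0 : ℝ) 1, G s) + 1, by positivity, fun x => ?_⟩
  calc _ ≤ ∫ s in Set.Ioo (0 : ℝ) 1, 16 / (1 + ‖x‖ ^ (2 + β)) * G s := by
        refine integral_mono_of_nonneg ?_ (hGint.const_mul _) ?_
        · refine (ae_restrict_iff' measurableSet_Ioo).2 (.of_forall fun s hs => ?_)
          exact mul_nonneg (Real.rpow_nonneg hs.1.le _)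
            (integral_nonneg fun y => by positivity)
        · refine (ae_restrict_iff' measurableSet_Ioo).2 (.of_forall fun s hs => ?_)
          obtain ⟨h0, h1⟩ := hs
          have h1' : 0 < 1 - s := sub_pos.2 h1
          have hle : s ^ ((β - 1) / 2) ≤ s ^ (-(1 / 2) : ℝ) :=
            Real.rpow_le_rpow_of_exponent_ge h0 h1.le (by linarith)
          have hmul : s ^ ((β - 1) / 2) * s ^ (-β / 2) = s ^ (-(1 / 2) : ℝ) := by
            rw [← Real.rpow_add h0]
            congr 1
            ring
          have hprod : s ^ ((β - 1) / 2) * (1 - s) ^ (-(1 / 2) : ℝ) ≤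
              s ^ (-(1 / 2) : ℝ) + (1 - s) ^ (-(1 / 2) : ℝ) :=
            (mul_le_mul_of_nonneg_right hle (by positivity)).trans (rpow_neg_half_mul_le h0 h1)
          calc _ ≤ s ^ ((β - 1) / 2) * (16 / (1 + ‖x‖ ^ (2 + β)) *
                ((1 - s) ^ (-(1 / 2) : ℝ) * A + s ^ (-β / 2) * B)) :=
                mul_le_mul_of_nonneg_left (integral_kernel_mul_weight_le hβ0 hβ1 h0 h1 x)
                  (by positivity)
            _ = 16 / (1 + ‖x‖ ^ (2 + β)) *
                (A * (s ^ ((β - 1) / 2) * (1 - s) ^ (-(1 / 2) : ℝ)) +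
                  B * (s ^ ((β - 1) / 2) * s ^ (-β / 2))) := by ring
            _ ≤ 16 / (1 + ‖x‖ ^ (2 + β)) * G s := by
                rw [hmul]
                simp only [hG]
                gcongr
    _ = 16 * (∫ s in Set.Ioo (0 : ℝ) 1, G s) / (1 + ‖x‖ ^ (2 + β)) := by
        rw [integral_const_mul]
        ring
    _ ≤ _ := by
        gcongr
        linarith
end
end
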